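/- Let A ⊆ B be an inclusion of C*-algebras. Then A is an essential corner of B (A = pBp for a projection p ∈ M(B) with [BAB] essential) if and only if there exists a conditional expectation E : B → A whose restriction to [ABA] is multiplicative and with ker E = {0}. Moreover such E is unique and is given by E(x) = pxp, and for any approximate unit (e_n) of A one has ‖xe_n − xp‖ → 0 for every x ∈ B, and [BA] = Bp. -/

import Mathlib

open scoped MultiplierAlgebra ComplexOrder

variable {B : Type*} [NonUnitalNormedRing B] [StarRing B] [CStarRing B]
  [NormedSpace ℂ B] [IsScalarTower ℂ B B] [SMulCommClass ℂ B B] [StarModule ℂ B]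
  [CompleteSpace B] [PartialOrder B] [StarOrderedRing B]

/-- The hereditary subalgebra `[ABA]` generated by `A` in `B`. -/
def hereditarySpan (A : NonUnitalStarSubalgebra ℂ B) : Set B :=
  closure (Submodule.span ℂ {z : B | ∃ a ∈ A, ∃ b ∈ A, ∃ x : B, z = a * x * b} : Set B)

/-- `E` is a conditional expectation of `B` onto `A` that is multiplicative on
`[ABA]` and whose kernel ideal `{x : E(BxB) = 0}` is trivial. -/
def IsFaithfulMultCondExp (A : NonUnitalStarSubalgebra ℂ B) (E : B →L[ℂ] B) : Prop :=
  (∀ x, E x ∈ A) ∧ (∀ a ∈ A, E a = a) ∧ (∀ x : B, 0 ≤ x → 0 ≤ E x) ∧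
  (∀ a ∈ A, ∀ x, E (a * x) = a * E x) ∧ (∀ a ∈ A, ∀ x, E (x * a) = E x * a) ∧
  (∀ x ∈ hereditarySpan A, ∀ y ∈ hereditarySpan A, E (x * y) = E x * E y) ∧
  (∀ x : B, (∀ b c : B, E (b * x * c) = 0) → x = 0)

/-- `A = pBp` is an essential corner of `B`: `p` is a projection in the
multiplier algebra and the closed two-sided ideal `[BAB]` generated by `A` is
essential. -/
def IsEssentialCornerProj (A : NonUnitalStarSubalgebra ℂ B) (p : 𝓜(ℂ, B)) : Prop :=
  IsSelfAdjoint p ∧ p * p = p ∧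
  (A : Set B) = Set.range (fun y => p.fst (p.snd y)) ∧
  (∀ x : B, (∀ y ∈ closure (Submodule.span ℂ
      {z : B | ∃ b c : B, ∃ a ∈ A, z = b * a * c} : Set B), x * y = 0) → x = 0)

open Filter Topology

/-- The C⋆-algebra structure on `B` assembled from its separate instances. -/
abbrev assembledCStarAlgebra (B : Type*) [NonUnitalNormedRing B] [StarRing B] [CStarRing B]
    [NormedSpace ℂ B] [IsScalarTower ℂ B B] [SMulCommClass ℂ B B] [StarModule ℂ B]
    [CompleteSpace B] : NonUnitalCStarAlgebra B where

section CStarRing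

variable {R : Type*} [NonUnitalNormedRing R] [StarRing R] [CStarRing R]

lemma eq_of_forall_mul_left_eq {x y : R} (h : ∀ z, z * x = z * y) : x = y := by
  rw [← sub_eq_zero, ← CStarRing.star_mul_self_eq_zero_iff, mul_sub, h, sub_self]

lemma eq_of_forall_mul_right_eq {x y : R} (h : ∀ z, x * z = y * z) : x = y := by
  rw [← sub_eq_zero, ← CStarRing.mul_star_self_eq_zero_iff, sub_mul, h, sub_self]

lemma eq_zero_of_star_mul_mul_eq_zero {x y : R} (h : star x * x * y = 0) : x * y = 0 := by
  rw [← CStarRing.star_mul_self_eq_zero_iff, star_mul, mul_assoc, ← mul_assoc (star x), h,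
    mul_zero]

lemma eq_zero_of_mul_mul_star_eq_zero {x y : R} (h : y * (x * star x) = 0) : y * x = 0 := by
  rw [← CStarRing.mul_star_self_eq_zero_iff, star_mul, ← mul_assoc, mul_assoc y, h, zero_mul]

lemma norm_mul_sub_eq_of_star_mul_self_eq {s w : R} (h : star w * w = star s * s) (e : R) :
    ‖w * e - w‖ = ‖s * e - s‖ := by
  have key : star (w * e - w) * (w * e - w) = star (s * e - s) * (s * e - s) := by
    have expand : ∀ v : R, star (v * e - v) * (v * e - v) =
        star e * (star v * v) * e - star e * (star v * v) - (star v * v) * e + star v * v := by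
      intro v
      simp only [star_sub, star_mul, mul_sub, sub_mul, mul_assoc]
      abel
    rw [expand, expand, h]
  rw [← mul_self_inj (norm_nonneg _) (norm_nonneg _), ← CStarRing.norm_star_mul_self, key,
    CStarRing.norm_star_mul_self]

end CStarRing

set_option linter.unusedSectionVars false

/-- A closed star subalgebra has a self-adjoint contractive approximate unit. -/
lemma exists_approximateUnit_filter (A : NonUnitalStarSubalgebra ℂ B)
    (hA : IsClosed (A : Set B)) :
    ∃ l : Filter B, l.NeBot ∧ (∀ᶠ e in l, e ∈ A ∧ ‖e‖ ≤ 1 ∧ star e = e) ∧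
      ∀ a ∈ A, Tendsto (fun e => a * e) l (𝓝 a) ∧ Tendsto (fun e => e * a) l (𝓝 a) := by
  let _ : NonUnitalCStarAlgebra B := assembledCStarAlgebra B
  have _ : IsClosed (A : Set B) := hA
  let _ : NonUnitalCStarAlgebra A := NonUnitalStarSubalgebra.nonUnitalCStarAlgebra A
  let _ : PartialOrder A := CStarAlgebra.spectralOrder A
  have _ : StarOrderedRing A := CStarAlgebra.spectralOrderedRing A
  have h := CStarAlgebra.increasingApproximateUnit (A := A)
  have hne := h.neBot
  refine ⟨(CStarAlgebra.approximateUnit A).map Subtype.val, inferInstance, ?_, ?_⟩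
  · rw [eventually_map]
    filter_upwards [h.eventually_norm, h.eventually_star_eq] with e h1 h2
    exact ⟨e.2, h1, congrArg Subtype.val h2⟩
  · intro a ha
    rw [tendsto_map'_iff, tendsto_map'_iff]
    exact ⟨(continuous_subtype_val.tendsto _).comp (h.tendsto_mul_left ⟨a, ha⟩),
      (continuous_subtype_val.tendsto _).comp (h.tendsto_mul_right ⟨a, ha⟩)⟩

lemma eq_zero_of_forall_mul_mul_eq_zero {A : NonUnitalStarSubalgebra ℂ B} {w : B} (hw : w ∈ A)
    (h : ∀ a ∈ A, ∀ b ∈ A, a * w * b = 0) : w = 0 := by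
  have h1 := h _ (star_mem hw) _ (star_mem hw)
  rw [mul_assoc, ← mul_assoc, mul_assoc] at h1
  rw [← CStarRing.mul_star_self_eq_zero_iff]
  apply eq_zero_of_star_mul_mul_eq_zero
  rw [mul_assoc, h1]

lemma mul_mul_mem_hereditarySpan {A : NonUnitalStarSubalgebra ℂ B} {a b : B} (ha : a ∈ A)
    (hb : b ∈ A) (x : B) : a * x * b ∈ hereditarySpan A :=
  subset_closure (Submodule.subset_span ⟨a, ha, b, hb, x, rfl⟩)

/-- A conditional expectation that is multiplicative on `[ABA]` and has trivial kernel ideal is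
the identity on `ABA`. -/
lemma IsFaithfulMultCondExp.mul_mul_eq {A : NonUnitalStarSubalgebra ℂ B} {E : B →L[ℂ] B}
    (hE : IsFaithfulMultCondExp A E) {a b : B} (ha : a ∈ A) (hb : b ∈ A) (x : B) :
    a * x * b = a * E x * b := by
  obtain ⟨hmem, hid, -, hl, hr, hmul, hker⟩ := hE
  set d := x - E x with hd
  have hEd : E d = 0 := by rw [hd, map_sub, hid _ (hmem x), sub_self]
  have key : ∀ a₁ ∈ A, ∀ a₂ ∈ A, ∀ b₁ ∈ A, ∀ b₂ ∈ A, a₁ * a₂ * d * (b₁ * b₂) = 0 := by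
    intro a₁ h₁ a₂ h₂ b₁ h₃ b₂ h₄
    refine hker _ fun f g => ?_
    refine eq_zero_of_forall_mul_mul_eq_zero (hmem _) fun u hu v hv => ?_
    rw [← hl u hu, ← hr v hv]
    have e1 : u * (f * (a₁ * a₂ * d * (b₁ * b₂)) * g) * v =
        (u * f * a₁) * ((a₂ * d * b₁) * (b₂ * g * v)) := by simp only [mul_assoc]
    have e2 : (a₂ * d * b₁) * (b₂ * g * v) = a₂ * (d * b₁ * b₂ * g) * v := by
      simp only [mul_assoc]
    rw [e1, hmul _ (mul_mul_mem_hereditarySpan hu h₁ _) _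
      (e2 ▸ mul_mul_mem_hereditarySpan h₂ hv _),
      hmul _ (mul_mul_mem_hereditarySpan h₂ h₃ _) _ (mul_mul_mem_hereditarySpan h₄ hv _),
      hr _ h₃, hl _ h₂, hEd]
    simp
  have h0 : a * (d * (b * star b)) = 0 := by
    apply eq_zero_of_star_mul_mul_eq_zero
    rw [← mul_assoc]
    exact key _ (star_mem ha) _ ha _ hb _ (star_mem hb)
  have h1 : a * d * b = 0 := by
    apply eq_zero_of_mul_mul_star_eq_zero
    rw [mul_assoc, h0]
  rwa [hd, mul_sub, sub_mul, sub_eq_zero] at h1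

lemma exists_clm_of_tendsto {l : Filter B} [l.NeBot] (F : B → B →L[ℂ] B)
    (hF : ∀ᶠ e in l, ‖F e‖ ≤ 1) (h : ∀ x, ∃ y, Tendsto (fun e => F e x) l (𝓝 y)) :
    ∃ R : B →L[ℂ] B, ∀ x, Tendsto (fun e => F e x) l (𝓝 (R x)) := by
  choose R hR using h
  let R' : B →ₗ[ℂ] B :=
    { toFun := R
      map_add' := fun x y => tendsto_nhds_unique (hR (x + y)) <| by
        simpa only [map_add] using (hR x).add (hR y)
      map_smul' := fun c x => tendsto_nhds_unique (hR (c • x)) <| by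
        simpa only [map_smul, RingHom.id_apply] using (hR x).const_smul c }
  refine ⟨R'.mkContinuous 1 fun x => ?_, hR⟩
  refine le_of_tendsto (hR x).norm ?_
  filter_upwards [hF] with e he
  exact (F e).le_of_opNorm_le he x

/-- Right multiplication by an approximate unit of `A` converges pointwise on `B`. -/
lemma IsFaithfulMultCondExp.exists_tendsto {A : NonUnitalStarSubalgebra ℂ B} {E : B →L[ℂ] B}
    (hE : IsFaithfulMultCondExp A E) {l : Filter B} [l.NeBot]
    (hl : ∀ᶠ e in l, e ∈ A ∧ ‖e‖ ≤ 1 ∧ star e = e)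
    (hl' : ∀ a ∈ A, Tendsto (fun e => a * e) l (𝓝 a) ∧ Tendsto (fun e => e * a) l (𝓝 a))
    (x : B) : ∃ y, Tendsto (fun e => x * e) l (𝓝 y) := by
  set h := E (star x * x) with hh
  have hlim := (hl' h (hE.1 _)).1
  apply cauchy_map_iff_exists_tendsto.mp
  rw [Metric.cauchy_iff]
  refine ⟨inferInstance, fun ε hε => ?_⟩
  have hev := hlim.eventually (Metric.ball_mem_nhds h (show 0 < ε ^ 2 / 4 by positivity))
  refine ⟨_, image_mem_map (hl.and hev), ?_⟩
  rintro _ ⟨e, ⟨⟨he, hn, -⟩, hd⟩, rfl⟩ _ ⟨f, ⟨⟨hf, hm, -⟩, hd'⟩, rfl⟩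
  have hef : e - f ∈ A := sub_mem he hf
  have e1 : star (x * e - x * f) * (x * e - x * f) = star (e - f) * (h * e - h * f) := by
    rw [← mul_sub, ← mul_sub, ← mul_assoc (star (e - f)), hh, ← hE.mul_mul_eq (star_mem hef) hef]
    simp only [star_mul, mul_assoc]
  have e2 : ‖star (e - f)‖ ≤ 2 := by
    rw [norm_star]; exact (norm_sub_le _ _).trans (by linarith)
  have e3 : dist (h * e) (h * f) < ε ^ 2 / 4 + ε ^ 2 / 4 :=
    (dist_triangle_right _ _ h).trans_lt (add_lt_add hd hd')
  rw [dist_eq_norm] at e3 ⊢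
  have e4 : ‖x * e - x * f‖ * ‖x * e - x * f‖ < ε * ε := by
    rw [← CStarRing.norm_star_mul_self, e1]
    calc _ ≤ ‖star (e - f)‖ * ‖h * e - h * f‖ := norm_mul_le _ _
      _ ≤ 2 * ‖h * e - h * f‖ := by gcongr
      _ < ε * ε := by linarith
  exact lt_of_mul_self_lt_mul_self₀ hε.le e4

lemma IsFaithfulMultCondExp.exists_isEssentialCornerProj {A : NonUnitalStarSubalgebra ℂ B}
    (hA : IsClosed (A : Set B)) {E : B →L[ℂ] B} (hE : IsFaithfulMultCondExp A E) :
    ∃ p : 𝓜(ℂ, B), IsEssentialCornerProj A p := by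
  obtain ⟨l, _, hl, hl'⟩ := exists_approximateUnit_filter A hA
  have hright := hE.exists_tendsto hl hl'
  have hleft : ∀ x, ∃ y, Tendsto (fun e => e * x) l (𝓝 y) := by
    intro x
    obtain ⟨y, hy⟩ := hright (star x)
    refine ⟨star y, ((continuous_star.tendsto _).comp hy).congr' ?_⟩
    filter_upwards [hl] with e he
    simp [he.2.2]
  obtain ⟨L, hL⟩ := exists_clm_of_tendsto (fun e => ContinuousLinearMap.mul ℂ B e)
    (hl.mono fun e he => (ContinuousLinearMap.opNorm_mul_apply_le ℂ B e).trans he.2.1) hleft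
  obtain ⟨R, hR⟩ := exists_clm_of_tendsto (fun e => (ContinuousLinearMap.mul ℂ B).flip e)
    (hl.mono fun e he => ContinuousLinearMap.opNorm_le_bound _ zero_le_one fun x => by
      refine (norm_mul_le x e).trans ?_
      rw [mul_comm]
      exact mul_le_mul_of_nonneg_right he.2.1 (norm_nonneg x)) hright
  change ∀ x, Tendsto (fun e => e * x) l (𝓝 (L x)) at hL
  change ∀ x, Tendsto (fun e => x * e) l (𝓝 (R x)) at hR
  have hLA : ∀ a ∈ A, L a = a := fun a ha => tendsto_nhds_unique (hL a) (hl' a ha).2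
  have hRA : ∀ a ∈ A, R a = a := fun a ha => tendsto_nhds_unique (hR a) (hl' a ha).1
  have hc : ∀ x y, R x * y = x * L y := fun x y =>
    tendsto_nhds_unique ((hR x).mul_const y) (by simpa only [mul_assoc] using (hL y).const_mul x)
  have hLR : ∀ x, L x = star (R (star x)) := fun x => by
    refine tendsto_nhds_unique (hL x)
      (((continuous_star.tendsto _).comp (hR (star x))).congr' ?_)
    filter_upwards [hl] with e he
    simp [he.2.2]
  have hRe : ∀ x, ∀ e ∈ A, R x * e = x * e := fun x e he => by rw [hc, hLA e he]
  have hRR : ∀ x, R (R x) = R x := fun x =>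
    tendsto_nhds_unique (hR (R x)) ((hR x).congr' (hl.mono fun e he => (hRe x e he.1).symm))
  have hLL : ∀ x, L (L x) = L x := fun x => by
    rw [hLR x, hLR, star_star, hRR]
  refine ⟨⟨(L, R), hc⟩, ?_, ?_, ?_, ?_⟩
  · apply DoubleCentralizer.ext
    refine Prod.ext (ContinuousLinearMap.ext fun x => (hLR x).symm)
      (ContinuousLinearMap.ext fun x => ?_)
    change star (L (star x)) = R x
    rw [hLR, star_star, star_star]
  · apply DoubleCentralizer.ext
    exact Prod.ext (ContinuousLinearMap.ext hLL) (ContinuousLinearMap.ext hRR)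
  · apply Set.Subset.antisymm
    · intro a ha
      exact ⟨a, by change L (R a) = a; rw [hRA a ha, hLA a ha]⟩
    · rintro _ ⟨y, rfl⟩
      change L (R y) ∈ (A : Set B)
      refine hA.mem_of_tendsto (hL (R y)) (hl.mono fun e he => ?_)
      refine hA.mem_of_tendsto ((hR y).const_mul e) (hl.mono fun f hf => ?_)
      rw [← mul_assoc, hE.mul_mul_eq he.1 hf.1]
      exact mul_mem (mul_mem he.1 (hE.1 y)) hf.1
  · intro x hx
    refine hE.2.2.2.2.2.2 x fun b c => ?_
    refine eq_zero_of_forall_mul_mul_eq_zero (hE.1 _) fun u hu v hv => ?_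
    have h0 : x * (c * v) = 0 := by
      apply eq_of_forall_mul_right_eq
      intro z
      rw [zero_mul, mul_assoc]
      exact hx _ (subset_closure (Submodule.subset_span ⟨c, z, v, hv, rfl⟩))
    rw [← hE.mul_mul_eq hu hv, mul_assoc u, mul_assoc (b * x), mul_assoc b, h0, mul_zero,
      mul_zero]

lemma DoubleCentralizer.fst_mul (p : 𝓜(ℂ, B)) (x y : B) : p.fst (x * y) = p.fst x * y :=
  eq_of_forall_mul_left_eq fun z => by
    rw [← p.central, ← mul_assoc, ← mul_assoc, p.central]

lemma DoubleCentralizer.snd_mul (p : 𝓜(ℂ, B)) (x y : B) : p.snd (x * y) = x * p.snd y :=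
  eq_of_forall_mul_right_eq fun z => by
    rw [p.central, mul_assoc, mul_assoc, p.central]

namespace IsEssentialCornerProj

variable {A : NonUnitalStarSubalgebra ℂ B} {p : 𝓜(ℂ, B)}

lemma fst_eq_star (hp : IsEssentialCornerProj A p) (x : B) :
    p.fst x = star (p.snd (star x)) := by
  conv_lhs => rw [← hp.1.star_eq]
  exact DoubleCentralizer.star_fst p x

lemma fst_fst (hp : IsEssentialCornerProj A p) (x : B) : p.fst (p.fst x) = p.fst x :=
  congrArg (fun q : 𝓜(ℂ, B) => q.fst x) hp.2.1

lemma compress_mem (hp : IsEssentialCornerProj A p) (x : B) : p.fst (p.snd x) ∈ A :=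
  (Set.ext_iff.mp hp.2.2.1 _).mpr ⟨x, rfl⟩

lemma fst_eq_self (hp : IsEssentialCornerProj A p) {a : B} (ha : a ∈ A) : p.fst a = a := by
  obtain ⟨y, rfl⟩ := (Set.ext_iff.mp hp.2.2.1 _).mp ha
  exact hp.fst_fst _

lemma snd_eq_self (hp : IsEssentialCornerProj A p) {a : B} (ha : a ∈ A) : p.snd a = a := by
  have h := hp.fst_eq_self (star_mem ha)
  rw [hp.fst_eq_star, star_star] at h
  exact star_injective h

lemma fst_eq_self_of_mem_hereditarySpan (hp : IsEssentialCornerProj A p) {x : B}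
    (hx : x ∈ hereditarySpan A) : p.fst x = x := by
  refine ContinuousLinearMap.eqOn_closure_span (f := p.fst) (g := .id ℂ B) ?_ hx
  rintro _ ⟨a, ha, b, -, x, rfl⟩
  rw [mul_assoc, p.fst_mul, hp.fst_eq_self ha]
  rfl

lemma snd_eq_self_of_mem_hereditarySpan (hp : IsEssentialCornerProj A p) {x : B}
    (hx : x ∈ hereditarySpan A) : p.snd x = x := by
  refine ContinuousLinearMap.eqOn_closure_span (f := p.snd) (g := .id ℂ B) ?_ hx
  rintro _ ⟨a, -, b, hb, x, rfl⟩
  rw [p.snd_mul, hp.snd_eq_self hb]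
  rfl

lemma compress_star_mul_self (hp : IsEssentialCornerProj A p) (y : B) :
    p.fst (p.snd (star y * y)) = star (p.snd y) * p.snd y := by
  rw [p.snd_mul, p.fst_mul, hp.fst_eq_star, star_star]

/-- The compression `x ↦ pxp` by the projection of an essential corner is a faithful
multiplicative conditional expectation. -/
lemma isFaithfulMultCondExp (hp : IsEssentialCornerProj A p) :
    IsFaithfulMultCondExp A (p.fst.comp p.snd) := by
  have hself : ∀ x ∈ hereditarySpan A, p.fst (p.snd x) = x := fun x hx => by
    rw [hp.snd_eq_self_of_mem_hereditarySpan hx, hp.fst_eq_self_of_mem_hereditarySpan hx]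
  refine ⟨hp.compress_mem, fun a ha => ?_, fun x hx => ?_, fun a ha x => ?_, fun a ha x => ?_,
    fun x hx y hy => ?_, fun x hx => ?_⟩
  all_goals simp only [ContinuousLinearMap.comp_apply] at *
  · rw [hp.snd_eq_self ha, hp.fst_eq_self ha]
  · let _ : NonUnitalCStarAlgebra B := assembledCStarAlgebra B
    obtain ⟨y, rfl⟩ := CStarAlgebra.nonneg_iff_eq_star_mul_self.mp hx
    rw [hp.compress_star_mul_self]
    exact star_mul_self_nonneg _
  · rw [p.snd_mul, p.fst_mul, hp.fst_eq_self ha]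
    conv_lhs => rw [← hp.snd_eq_self ha]
    rw [p.central]
  · rw [p.snd_mul, hp.snd_eq_self ha, ← p.fst_mul (p.snd x), p.central, hp.fst_eq_self ha]
  · rw [hself x hx, hself y hy, p.snd_mul, p.fst_mul,
      hp.snd_eq_self_of_mem_hereditarySpan hy, hp.fst_eq_self_of_mem_hereditarySpan hx]
  · refine hp.2.2.2 x fun y hy => ?_
    refine ContinuousLinearMap.eqOn_closure_span (f := ContinuousLinearMap.mul ℂ B x)
      (g := 0) ?_ hy
    rintro _ ⟨b, c, a, ha, rfl⟩
    change x * (b * a * c) = 0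
    have h0 : x * (b * a) = 0 := by
      rw [← CStarRing.star_mul_self_eq_zero_iff]
      have h := hx (star (b * a) * star x) (b * a)
      rw [p.snd_mul, p.snd_mul, hp.snd_eq_self ha, mul_assoc, mul_assoc, star_mul, mul_assoc,
        p.fst_mul, hp.fst_eq_self (star_mem ha)] at h
      simpa only [star_mul, mul_assoc] using h
    rw [← mul_assoc, h0, zero_mul]

/-- A faithful multiplicative conditional expectation onto an essential corner is the
compression. -/
lemma condExp_eq_compress (hp : IsEssentialCornerProj A p) {E : B →L[ℂ] B}
    (hE : IsFaithfulMultCondExp A E) (x : B) : E x = p.fst (p.snd x) := by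
  rw [← sub_eq_zero]
  refine eq_zero_of_forall_mul_mul_eq_zero (sub_mem (hE.1 x) (hp.compress_mem x))
    fun a ha b hb => ?_
  rw [mul_sub, sub_mul, ← hE.mul_mul_eq ha hb, hp.isFaithfulMultCondExp.mul_mul_eq ha hb x,
    ContinuousLinearMap.comp_apply, sub_self]

lemma exists_sqrt (hp : IsEssentialCornerProj A p) (x : B) :
    ∃ s ∈ A, star (p.snd x) * p.snd x = star s * s := by
  let _ : NonUnitalCStarAlgebra B := assembledCStarAlgebra B
  set a := star (p.snd x) * p.snd x with ha
  have ha0 : 0 ≤ a := star_mul_self_nonneg _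
  have haA : a ∈ A := by rw [ha, ← hp.compress_star_mul_self]; exact hp.compress_mem _
  have hss : CFC.sqrt a * CFC.sqrt a = a := CFC.sqrt_mul_sqrt_self a
  have hsa : star (CFC.sqrt a) = CFC.sqrt a := (CFC.sqrt_nonneg a).isSelfAdjoint.star_eq
  generalize CFC.sqrt a = s at hss hsa
  have hL : p.fst s = star (p.snd s) := by rw [hp.fst_eq_star, hsa]
  have hR : p.snd s = s := by
    symm
    rw [← sub_eq_zero, ← CStarRing.star_mul_self_eq_zero_iff, star_sub, hsa, ← hL, mul_sub,
      sub_mul, sub_mul, ← p.snd_mul, ← p.fst_mul, ← p.fst_mul, ← p.snd_mul, hss,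
      hp.snd_eq_self haA, hp.fst_eq_self haA]
    simp
  refine ⟨s, ?_, by rw [hsa, hss]⟩
  have h := hp.compress_mem s
  rwa [hR, hL, hR, hsa] at h

lemma tendsto_mul (hp : IsEssentialCornerProj A p) {ι : Type*} {l : Filter ι} {e : ι → B}
    (he : ∀ᶠ n in l, e n ∈ A) (h : ∀ a ∈ A, Tendsto (fun n => a * e n) l (𝓝 a)) (x : B) :
    Tendsto (fun n => x * e n) l (𝓝 (p.snd x)) := by
  obtain ⟨s, hs, hsx⟩ := hp.exists_sqrt x
  have hs' := tendsto_iff_norm_sub_tendsto_zero.mp (h s hs)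
  refine tendsto_iff_norm_sub_tendsto_zero.mpr (hs'.congr' ?_)
  filter_upwards [he] with n hn
  rw [← norm_mul_sub_eq_of_star_mul_self_eq hsx, p.central, hp.fst_eq_self hn]

lemma closure_span_mul_eq (hp : IsEssentialCornerProj A p) (hA : IsClosed (A : Set B)) :
    closure (Submodule.span ℂ {z : B | ∃ b : B, ∃ a ∈ A, z = b * a} : Set B) =
      {x : B | p.snd x = x} := by
  apply Set.Subset.antisymm
  · intro x hx
    refine ContinuousLinearMap.eqOn_closure_span (f := p.snd) (g := .id ℂ B) ?_ hx
    rintro _ ⟨b, a, ha, rfl⟩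
    rw [p.snd_mul, hp.snd_eq_self ha]
    rfl
  · intro x hx
    obtain ⟨l, _, hl, hl'⟩ := exists_approximateUnit_filter A hA
    have h := hp.tendsto_mul (hl.mono fun e he => he.1) (fun a ha => (hl' a ha).1) x
    rw [show p.snd x = x from hx] at h
    exact mem_closure_of_tendsto h (hl.mono fun e he => Submodule.subset_span ⟨x, e, he.1, rfl⟩)

end IsEssentialCornerProj

/-- `A` is an essential corner of `B` iff there is a conditional expectation
`E : B → A` multiplicative on `[ABA]` with `ker E = {0}`.  Moreover such an `E`
is unique, equal to the compression `x ↦ pxp`; one has `xeₙ → xp` for every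
approximate unit `(eₙ)` of `A` and every `x ∈ B`; and `[BA] = Bp`. -/
theorem essentialCorner_iff_faithful_condExp (A : NonUnitalStarSubalgebra ℂ B)
    (hA : IsClosed (A : Set B)) :
    ((∃ p : 𝓜(ℂ, B), IsEssentialCornerProj A p) ↔
      (∃ E : B →L[ℂ] B, IsFaithfulMultCondExp A E)) ∧
    ∀ p : 𝓜(ℂ, B), IsEssentialCornerProj A p →
      ∀ E : B →L[ℂ] B, IsFaithfulMultCondExp A E →
        (∀ x, E x = p.fst (p.snd x)) ∧
        (∀ (ι : Type) (l : Filter ι), l.NeBot → ∀ e : ι → B, (∀ n, e n ∈ A) →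
          (∀ a ∈ A, Filter.Tendsto (fun n => a * e n) l (nhds a) ∧
            Filter.Tendsto (fun n => e n * a) l (nhds a)) →
          ∀ x : B, Filter.Tendsto (fun n => x * e n) l (nhds (p.snd x))) ∧
        closure (Submodule.span ℂ {z : B | ∃ b : B, ∃ a ∈ A, z = b * a} : Set B) =
          {x : B | p.snd x = x} := by
  refine ⟨⟨fun ⟨_, hp⟩ => ⟨_, hp.isFaithfulMultCondExp⟩,
    fun ⟨_, hE⟩ => hE.exists_isEssentialCornerProj hA⟩, fun p hp E hE =>
    ⟨hp.condExp_eq_compress hE, ?_, hp.closure_span_mul_eq hA⟩⟩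
  intro ι l _ e he h x
  exact hp.tendsto_mul (.of_forall he) (fun a ha => (h a ha).1) x
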